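/- arXiv:1104.0402 — 4 statements merged into one kernel-verified Lean document; each statement's English description precedes it below -/
import Mathlib

section
/- With the standard setup (G = B ⋉ A under θ, free presentations of A and B with kernels R₁ ≤ F₁ and R₂ ≤ F₂, F = F₁ * F₂, R the kernel of the induced map F → G, and S the normal closure in F of {f₁⁻¹ f̄₁ [f₂, f₁] : ν₁(f̄₁) = θ(ν₂ f₂)(ν₁ f₁)}): both R₁ and the commutator subgroup [R₂, F₁] are contained in S. -/
open Subgroup Monoid Monoid.Coprod Pointwise

namespace Paper

/-- The commutator `[x, y] = x⁻¹ y⁻¹ x y` (the convention used in the paper). -/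
def pc {G : Type*} [Group G] (x y : G) : G := x⁻¹ * y⁻¹ * x * y

/-- Left-normed iterated commutator `[x, f₁, f₂, …, f_c] = […[[x,f₁],f₂]…,f_c]`. -/
def itc {G : Type*} [Group G] (x : G) (l : List G) : G := l.foldl pc x

/-- Iterated commutator subgroup `[H, K, K, …, K]` (`c` copies of `K`);
in particular `itC R ⊤ c = [R, _c F]` and `itC H K 0 = H`. -/
def itC {G : Type*} [Group G] (H K : Subgroup G) : ℕ → Subgroup G
  | 0 => H
  | n + 1 => ⁅itC H K n, K⁆

variable (F₁ F₂ : Type*) [Group F₁] [Group F₂]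

/-- `F₁` regarded as a subgroup of the free product `F = F₁ ∗ F₂`. -/
def Fs₁ : Subgroup (F₁ ∗ F₂) := (Coprod.inl : F₁ →* F₁ ∗ F₂).range

/-- `F₂` regarded as a subgroup of the free product `F = F₁ ∗ F₂`. -/
def Fs₂ : Subgroup (F₁ ∗ F₂) := (Coprod.inr : F₂ →* F₁ ∗ F₂).range

variable {A B : Type*} [Group A] [Group B]

/-- `R₁ = ker ν₁`, regarded as a subgroup of `F = F₁ ∗ F₂`. -/
def Rs₁ (ν₁ : F₁ →* A) : Subgroup (F₁ ∗ F₂) := ν₁.ker.map Coprod.inl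

/-- `R₂ = ker ν₂`, regarded as a subgroup of `F = F₁ ∗ F₂`. -/
def Rs₂ (ν₂ : F₂ →* B) : Subgroup (F₁ ∗ F₂) := ν₂.ker.map Coprod.inr

/-- The homomorphism `ν : F = F₁ ∗ F₂ → G = A ⋊[θ] B` induced by `ν₁` and `ν₂`. -/
def νF (θ : B →* MulAut A) (ν₁ : F₁ →* A) (ν₂ : F₂ →* B) : (F₁ ∗ F₂) →* A ⋊[θ] B :=
  Coprod.lift (SemidirectProduct.inl.comp ν₁) (SemidirectProduct.inr.comp ν₂)

/-- The subgroup `S`: the normal closure in `F = F₁ ∗ F₂` of the set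
`{f₁⁻¹ f̄₁ [f₂, f₁] | f₁, f̄₁ ∈ F₁, f₂ ∈ F₂, ν₁(f̄₁) = θ(ν₂ f₂)(ν₁ f₁)}`. -/
def Ssub (θ : B →* MulAut A) (ν₁ : F₁ →* A) (ν₂ : F₂ →* B) : Subgroup (F₁ ∗ F₂) :=
  Subgroup.normalClosure
    {x | ∃ f₁ f₁' : F₁, ∃ f₂ : F₂, ν₁ f₁' = θ (ν₂ f₂) (ν₁ f₁) ∧
      x = (Coprod.inl f₁)⁻¹ * Coprod.inl f₁' * pc (Coprod.inr f₂) (Coprod.inl f₁)}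

/-- `∏[R₂,F₁,F₂]_c`: the normal closure in `F = F₁ ∗ F₂` of all left-normed commutators
`[r₂, f₁, …, f_c]` with `r₂ ∈ R₂`, each `f_i ∈ F₁ ∪ F₂`, and at least one `f_k ∈ F₁`. -/
def Pc (ν₂ : F₂ →* B) (c : ℕ) : Subgroup (F₁ ∗ F₂) :=
  Subgroup.normalClosure
    {x | ∃ r₂ ∈ Rs₂ F₁ F₂ ν₂, ∃ l : List (F₁ ∗ F₂), l.length = c ∧
      (∀ f ∈ l, f ∈ (Fs₁ F₁ F₂ : Set (F₁ ∗ F₂)) ∪ (Fs₂ F₁ F₂ : Set (F₁ ∗ F₂))) ∧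
      (∃ f ∈ l, f ∈ Fs₁ F₁ F₂) ∧ x = itc r₂ l}


/-- **Theorem 2.1 (i).** In the standard setup, both `R₁` and the commutator subgroup
`[R₂, F₁]` are contained in `S`. -/
theorem R₁_and_commutator_R₂_F₁_le_S
    {A B F₁ F₂ : Type*} [Group A] [Group B] [Group F₁] [Group F₂]
    [IsFreeGroup F₁] [IsFreeGroup F₂]
    (θ : B →* MulAut A) (ν₁ : F₁ →* A) (ν₂ : F₂ →* B)
    (hν₁ : Function.Surjective ν₁) (hν₂ : Function.Surjective ν₂) :
    Rs₁ F₁ F₂ ν₁ ≤ Ssub F₁ F₂ θ ν₁ ν₂ ∧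
    ⁅Rs₂ F₁ F₂ ν₂, Fs₁ F₁ F₂⁆ ≤ Ssub F₁ F₂ θ ν₁ ν₂ := by
  refine ⟨?_, ?_⟩
  · rintro _ ⟨r, hr, rfl⟩
    refine Subgroup.subset_normalClosure ⟨1, r, 1, ?_, ?_⟩
    · simpa using MonoidHom.mem_ker.1 hr
    · simp [pc]
  · rw [Subgroup.commutator_le]
    rintro _ ⟨r, hr, rfl⟩ _ ⟨f, rfl⟩
    refine Subgroup.subset_normalClosure ⟨f⁻¹, f⁻¹, r⁻¹, ?_, ?_⟩
    · simp [MonoidHom.mem_ker.1 hr]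
    · simp [pc, commutatorElement_def]

end Paper
end

section
/- (Tahara) Let G = B ⋉ A be the semidirect product of a normal subgroup A and a subgroup B. Then the Schur multiplicator M(B) is a direct factor of M(G), i.e., there is a group C with M(G) ≅ M(B) ⊕ C. -/
open Subgroup Monoid Monoid.Coprod Pointwise

namespace Paper

variable (F₁ F₂ : Type*) [Group F₁] [Group F₂]

variable {A B : Type*} [Group A] [Group B]

instance itC_normal {G : Type*} [Group G] (H K : Subgroup G) [hH : H.Normal] [hK : K.Normal] :
    ∀ c, (itC H K c).Normal
  | 0 => hH
  | c + 1 => letI := itC_normal H K c; Subgroup.commutator_normal _ _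

instance Ssub_normal {A B F₁ F₂ : Type*} [Group A] [Group B] [Group F₁] [Group F₂]
    (θ : B →* MulAut A) (ν₁ : F₁ →* A) (ν₂ : F₂ →* B) : (Ssub F₁ F₂ θ ν₁ ν₂).Normal :=
  Subgroup.normalClosure_normal

instance Pc_normal {B F₁ F₂ : Type*} [Group B] [Group F₁] [Group F₂]
    (ν₂ : F₂ →* B) (c : ℕ) : (Pc F₁ F₂ ν₂ c).Normal :=
  Subgroup.normalClosure_normal

/-- A free group lifts along every surjective homomorphism. -/
theorem exists_lift_of_isFreeGroup {E : Type*} [Group E] [IsFreeGroup E]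
    {M N : Type*} [Group M] [Group N] (p : M →* N) (hp : Function.Surjective p) (f : E →* N) :
    ∃ g : E →* M, p.comp g = f := by
  refine ⟨IsFreeGroup.lift fun i => Function.surjInv hp (f (IsFreeGroup.of i)), ?_⟩
  refine IsFreeGroup.ext_hom fun i => ?_
  simp [Function.surjInv_eq]

/-- The group `(ker π ∩ E') / [ker π, E]`, which for a free presentation `π : E ↠ H` is the
Schur multiplicator of `H`. -/
abbrev Multiplicator {E H : Type*} [Group E] [Group H] (π : E →* H) : Type _ :=
  ↥(π.ker ⊓ commutator E) ⧸ (⁅π.ker, (⊤ : Subgroup E)⁆.subgroupOf (π.ker ⊓ commutator E))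

section Multiplicator

open scoped commutatorElement

variable {E₁ E₂ E₃ H₁ H₂ H₃ : Type*} [Group E₁] [Group E₂] [Group E₃]
  [Group H₁] [Group H₂] [Group H₃]

theorem map_mem_ker_of_comp_eq {π₁ : E₁ →* H₁} {π₂ : E₂ →* H₂} {f : E₁ →* E₂} {φ : H₁ →* H₂}
    (h : π₂.comp f = φ.comp π₁) {x : E₁} (hx : x ∈ π₁.ker) : f x ∈ π₂.ker := by
  rw [MonoidHom.mem_ker] at hx ⊢
  rw [← MonoidHom.comp_apply, h, MonoidHom.comp_apply, hx, map_one]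

theorem map_mem_commutator (f : E₁ →* E₂) {x : E₁} (hx : x ∈ commutator E₁) :
    f x ∈ commutator E₂ := by
  have h := Subgroup.mem_map_of_mem f hx
  rw [commutator_def, Subgroup.map_commutator] at h
  exact Subgroup.commutator_mono le_top le_top h

theorem map_mem_commutator_ker_top {π₁ : E₁ →* H₁} {π₂ : E₂ →* H₂} {f : E₁ →* E₂}
    {φ : H₁ →* H₂} (h : π₂.comp f = φ.comp π₁) {x : E₁}
    (hx : x ∈ ⁅π₁.ker, (⊤ : Subgroup E₁)⁆) : f x ∈ ⁅π₂.ker, (⊤ : Subgroup E₂)⁆ := by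
  have h' := Subgroup.mem_map_of_mem f hx
  rw [Subgroup.map_commutator] at h'
  refine Subgroup.commutator_mono ?_ le_top h'
  rintro _ ⟨y, hy, rfl⟩
  exact map_mem_ker_of_comp_eq h hy

/-- The homomorphism of multiplicators induced by a morphism of presentations. -/
def multiplicatorMap {π₁ : E₁ →* H₁} {π₂ : E₂ →* H₂} (f : E₁ →* E₂) (φ : H₁ →* H₂)
    (h : π₂.comp f = φ.comp π₁) : Multiplicator π₁ →* Multiplicator π₂ :=
  QuotientGroup.map _ _
    ((f.comp (π₁.ker ⊓ commutator E₁).subtype).codRestrict (π₂.ker ⊓ commutator E₂) fun x =>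
      ⟨map_mem_ker_of_comp_eq h x.2.1, map_mem_commutator f x.2.2⟩)
    fun _ hx => map_mem_commutator_ker_top h hx

theorem multiplicatorMap_comp {π₁ : E₁ →* H₁} {π₂ : E₂ →* H₂} {π₃ : E₃ →* H₃}
    (f : E₁ →* E₂) (φ : H₁ →* H₂) (h : π₂.comp f = φ.comp π₁)
    (g : E₂ →* E₃) (ψ : H₂ →* H₃) (h' : π₃.comp g = ψ.comp π₂)
    (h'' : π₃.comp (g.comp f) = (ψ.comp φ).comp π₁) (x : Multiplicator π₁) :
    multiplicatorMap g ψ h' (multiplicatorMap f φ h x) =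
      multiplicatorMap (g.comp f) (ψ.comp φ) h'' x := by
  induction x using QuotientGroup.induction_on with
  | H x => rfl

/-- An endomorphism of `E` over `H` agrees with the identity on `E'` modulo `[ker π, E]`. -/
theorem map_mul_inv_mem_of_mem_commutator {π : E₁ →* H₁} {f : E₁ →* E₁} (h : π.comp f = π)
    {x : E₁} (hx : x ∈ commutator E₁) : f x * x⁻¹ ∈ ⁅π.ker, (⊤ : Subgroup E₁)⁆ := by
  let q := QuotientGroup.mk' ⁅π.ker, (⊤ : Subgroup E₁)⁆
  have central : ∀ y, q (f y * y⁻¹) ∈ Subgroup.center (E₁ ⧸ ⁅π.ker, (⊤ : Subgroup E₁)⁆) := by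
    intro y
    rw [Subgroup.mem_center_iff]
    intro z
    obtain ⟨z, rfl⟩ := QuotientGroup.mk'_surjective _ z
    have hy : f y * y⁻¹ ∈ π.ker := by
      rw [MonoidHom.mem_ker, map_mul, ← MonoidHom.comp_apply, h, map_inv, mul_inv_cancel]
    have hc : q ⁅f y * y⁻¹, z⁆ = 1 :=
      (QuotientGroup.eq_one_iff _).2 (Subgroup.commutator_mem_commutator hy (Subgroup.mem_top z))
    rw [map_commutatorElement, commutatorElement_eq_one_iff_mul_comm] at hc
    exact hc.symm
  let d : E₁ →* Subgroup.center (E₁ ⧸ ⁅π.ker, (⊤ : Subgroup E₁)⁆) :=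
    MonoidHom.mk' (fun y => ⟨q (f y * y⁻¹), central y⟩) fun a b => by
      ext
      have hb := Subgroup.mem_center_iff.1 (central b) (q a⁻¹)
      calc q (f (a * b) * (a * b)⁻¹) = q (f a) * (q (f b * b⁻¹) * q a⁻¹) := by
            simp only [map_mul, mul_inv_rev, mul_assoc]
        _ = q (f a * a⁻¹) * q (f b * b⁻¹) := by
            rw [← hb, ← mul_assoc, ← map_mul]
  have hd : commutator E₁ ≤ d.ker := Subgroup.commutator_le.2 fun a _ b _ => by
    rw [MonoidHom.mem_ker, map_commutatorElement, commutatorElement_eq_one_iff_mul_comm]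
    exact Subtype.ext (Subgroup.mem_center_iff.1 (d b).2 _)
  exact (QuotientGroup.eq_one_iff _).1 (congrArg Subtype.val (hd hx))

theorem multiplicatorMap_eq_self {π : E₁ →* H₁} {f : E₁ →* E₁} {φ : H₁ →* H₁}
    (h : π.comp f = φ.comp π) (h' : π.comp f = π) (x : Multiplicator π) :
    multiplicatorMap f φ h x = x := by
  induction x using QuotientGroup.induction_on with
  | H x =>
    refine (QuotientGroup.eq_iff_div_mem).2 ?_
    rw [div_eq_mul_inv]
    exact map_mul_inv_mem_of_mem_commutator h' x.2.2

theorem Multiplicator.mul_comm {π : E₁ →* H₁} (x y : Multiplicator π) : x * y = y * x := by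
  induction x using QuotientGroup.induction_on with
  | H x =>
    induction y using QuotientGroup.induction_on with
    | H y =>
      rw [← commutatorElement_eq_one_iff_mul_comm]
      exact (QuotientGroup.eq_one_iff ⁅x, y⁆).2
        (Subgroup.commutator_mem_commutator x.2.1 (Subgroup.mem_top (y : E₁)))

end Multiplicator

/-- A retract of a commutative group is a direct factor. -/
def mulEquivProdKerOfLeftInverse {M N : Type*} [Group M] [Group N]
    (comm : ∀ x y : M, x * y = y * x) (p : M →* N) (s : N →* M) (hps : ∀ n, p (s n) = n) :
    M ≃* N × p.ker where
  toFun x := (p x, ⟨x * (s (p x))⁻¹, by simp [MonoidHom.mem_ker, hps]⟩)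
  invFun y := y.2 * s y.1
  left_inv x := by simp
  right_inv y := by
    have h : p y.2 = 1 := y.2.2
    ext <;> simp [h, hps]
  map_mul' x y := by
    ext
    · simp
    · simp only [map_mul, Prod.mk_mul_mk, Subgroup.coe_mul, mul_inv_rev]
      rw [mul_assoc, ← mul_assoc y, comm (y * _), mul_assoc]

/-- A complement of a normal subgroup is a retract of the whole group. -/
theorem exists_retraction_of_sup_eq_top {G : Type*} [Group G] (K H : Subgroup G) (hK : K.Normal)
    (hsup : K ⊔ H = ⊤) (hinf : K ⊓ H = ⊥) : ∃ ρ : G →* H, ∀ b : H, ρ b = b := by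
  have hc : H.IsComplement' K := by
    refine Subgroup.isComplement'_of_disjoint_and_mul_eq_univ ?_ ?_
    · rw [disjoint_iff, inf_comm, hinf]
    · rw [← Subgroup.mul_normal, sup_comm, hsup, Subgroup.coe_top]
  refine ⟨hc.QuotientMulEquiv.toMonoidHom.comp (QuotientGroup.mk' K), fun b => ?_⟩
  exact hc.QuotientMulEquiv.apply_symm_apply b

/-- **Corollary 2.3 (Tahara).** Let `G = B ⋉ A` be the semidirect product of a normal
subgroup `A` and a subgroup `B`.  Then the Schur multiplicator `M(B)` is a direct factor
of `M(G)`: there is a group `C` with `M(G) ≅ M(B) ⊕ C`.  Here the Schur multiplicators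
are computed from arbitrary free presentations `π : F ↠ G` and `πB : FB ↠ B` as
`M(G) = (ker π ∩ F') / [ker π, F]` and `M(B) = (ker πB ∩ FB') / [ker πB, FB]`. -/
theorem schur_multiplicator_direct_factor
    {G : Type u} [Group G] (A Bs : Subgroup G)
    (hA : A.Normal) (hsup : A ⊔ Bs = ⊤) (hinf : A ⊓ Bs = ⊥)
    {F FB : Type u} [Group F] [Group FB] [IsFreeGroup F] [IsFreeGroup FB]
    (π : F →* G) (hπ : Function.Surjective π)
    (πB : FB →* ↥Bs) (hπB : Function.Surjective πB) :
    ∃ (C : Type u) (_ : Group C),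
      Nonempty
        ((↥(π.ker ⊓ commutator F) ⧸
            (⁅π.ker, (⊤ : Subgroup F)⁆.subgroupOf (π.ker ⊓ commutator F))) ≃*
          ((↥(πB.ker ⊓ commutator FB) ⧸
              (⁅πB.ker, (⊤ : Subgroup FB)⁆.subgroupOf (πB.ker ⊓ commutator FB))) × C)) := by
  obtain ⟨ρ, hρ⟩ := exists_retraction_of_sup_eq_top A Bs hA hsup hinf
  obtain ⟨f, hf⟩ := exists_lift_of_isFreeGroup π hπ (Bs.subtype.comp πB)
  obtain ⟨g, hg⟩ := exists_lift_of_isFreeGroup πB hπB (ρ.comp π)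
  have hρB : ρ.comp Bs.subtype = MonoidHom.id _ := MonoidHom.ext hρ
  have hgf : πB.comp (g.comp f) = (ρ.comp Bs.subtype).comp πB := by
    rw [← MonoidHom.comp_assoc, hg, MonoidHom.comp_assoc, hf, MonoidHom.comp_assoc]
  refine ⟨(multiplicatorMap g ρ hg).ker, inferInstance,
    ⟨mulEquivProdKerOfLeftInverse Multiplicator.mul_comm (multiplicatorMap g ρ hg)
      (multiplicatorMap f Bs.subtype hf) fun x => ?_⟩⟩
  rw [multiplicatorMap_comp f Bs.subtype hf g ρ hg hgf]
  exact multiplicatorMap_eq_self hgf (by rw [hgf, hρB, MonoidHom.id_comp]) x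

end Paper
end

section
/- With the standard setup (G = B ⋉ A under θ, free presentations of A and B, F = F₁ * F₂, and S the normal closure in F of {f₁⁻¹ f̄₁ [f₂, f₁] : ν₁(f̄₁) = θ(ν₂ f₂)(ν₁ f₁)}): S is contained in the subgroup F₁[F₁,F₂] generated by F₁ and the commutator subgroup [F₁,F₂]. -/
open Subgroup Monoid Monoid.Coprod Pointwise

namespace Paper

variable (F₁ F₂ : Type*) [Group F₁] [Group F₂]

variable {A B : Type*} [Group A] [Group B]

open scoped commutatorElement in
/-- In a group generated by two subgroups `H` and `K`, the subgroup `H[H,K]` is normal. -/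
theorem normal_sup_commutator_of_sup_eq_top {G : Type*} [Group G] {H K : Subgroup G}
    (hHK : H ⊔ K = ⊤) : (H ⊔ ⁅H, K⁆).Normal := by
  have conj_left : ∀ z ∈ K, ∀ x ∈ H, z * x * z⁻¹ ∈ H ⊔ ⁅H, K⁆ := fun z hz x hx => by
    have h : z * x * z⁻¹ = x * ⁅x⁻¹, z⁆ := by rw [commutatorElement_def]; group
    rw [h]
    exact mul_mem (mem_sup_left hx)
      (mem_sup_right (commutator_mem_commutator (inv_mem hx) hz))
  have conj_mem : ∀ z ∈ K, H ⊔ ⁅H, K⁆ ≤ (H ⊔ ⁅H, K⁆).comap (MulAut.conj z).toMonoidHom := by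
    refine fun z hz => sup_le (conj_left z hz) (commutator_le.mpr fun x hx y hy => ?_)
    have h : z * ⁅x, y⁆ * z⁻¹ = z * x * z⁻¹ * (z * y * x⁻¹ * (z * y)⁻¹) := by
      rw [commutatorElement_def]; group
    change z * ⁅x, y⁆ * z⁻¹ ∈ H ⊔ ⁅H, K⁆
    rw [h]
    exact mul_mem (conj_left z hz x hx) (conj_left _ (mul_mem hz hy) _ (inv_mem hx))
  have hK : K ≤ normalizer (H ⊔ ⁅H, K⁆ : Subgroup G) := fun z hz => by
    refine mem_normalizer_iff.mpr fun n => ⟨fun hn => conj_mem z hz hn, fun hn => ?_⟩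
    simpa [mul_assoc] using conj_mem z⁻¹ (inv_mem hz) hn
  exact normalizer_eq_top_iff.mp
    (top_le_iff.mp (hHK.symm.le.trans (sup_le (le_sup_left.trans le_normalizer) hK)))

/-- With the standard setup, the subgroup `S` is contained in the subgroup `F₁[F₁,F₂]`
of `F = F₁ ∗ F₂` generated by `F₁` and the commutator subgroup `[F₁,F₂]`. -/
theorem Ssub_le_F₁_commutator
    {A B F₁ F₂ : Type*} [Group A] [Group B] [Group F₁] [Group F₂]
    [IsFreeGroup F₁] [IsFreeGroup F₂]
    (θ : B →* MulAut A) (ν₁ : F₁ →* A) (ν₂ : F₂ →* B)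
    (hν₁ : Function.Surjective ν₁) (hν₂ : Function.Surjective ν₂) :
    Ssub F₁ F₂ θ ν₁ ν₂ ≤ Fs₁ F₁ F₂ ⊔ ⁅Fs₁ F₁ F₂, Fs₂ F₁ F₂⁆ := by
  have hN : (Fs₁ F₁ F₂ ⊔ ⁅Fs₁ F₁ F₂, Fs₂ F₁ F₂⁆).Normal :=
    normal_sup_commutator_of_sup_eq_top Coprod.range_inl_sup_range_inr
  refine normalClosure_le_normal ?_
  rintro _ ⟨f₁, f₁', f₂, -, rfl⟩
  have inl_mem : ∀ x : F₁, (Coprod.inl x : F₁ ∗ F₂) ∈ Fs₁ F₁ F₂ ⊔ ⁅Fs₁ F₁ F₂, Fs₂ F₁ F₂⁆ :=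
    fun x => mem_sup_left ⟨x, rfl⟩
  refine mul_mem (mul_mem (inv_mem (inl_mem f₁)) (inl_mem f₁')) (mul_mem ?_ (inl_mem f₁))
  simpa using hN.conj_mem _ (inv_mem (inl_mem f₁)) (Coprod.inr f₂)⁻¹

end Paper
end

section
/- With the standard setup, fix c ≥ 1 and let K = [R₂, _c F₂] · ∏[R₂,F₁,F₂]_c · [S, _c F], a normal subgroup of F = F₁ * F₂. Then in the quotient F/K the images of F₂ and of the subgroup F₁[F₁,F₂] intersect trivially, so F/K is the semidirect product of the image of F₂ and the image of F₁[F₁,F₂]. -/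
open Subgroup Monoid Monoid.Coprod Pointwise

namespace Paper

variable (F₁ F₂ : Type*) [Group F₁] [Group F₂]

variable {A B : Type*} [Group A] [Group B]

theorem map_pc {G G' : Type*} [Group G] [Group G'] (φ : G →* G') (x y : G) :
    φ (pc x y) = pc (φ x) (φ y) := by
  simp [pc]

theorem map_itc {G G' : Type*} [Group G] [Group G'] (φ : G →* G') (x : G) (l : List G) :
    φ (itc x l) = itc (φ x) (l.map φ) := by
  induction l generalizing x with
  | nil => rfl
  | cons y l ih => simpa [itc, map_pc] using ih (pc x y)

theorem itc_one_left {G : Type*} [Group G] (l : List G) : itc 1 l = 1 := by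
  induction l with
  | nil => rfl
  | cons y l ih => simpa [itc, pc] using ih

theorem itc_eq_one_of_one_mem {G : Type*} [Group G] (x : G) {l : List G} (h : 1 ∈ l) :
    itc x l = 1 := by
  induction l generalizing x with
  | nil => simp at h
  | cons y l ih =>
    rcases List.mem_cons.1 h with h | h
    · subst h
      simpa [itc, pc] using itc_one_left l
    · exact ih (pc x y) h

theorem itC_le_left {G : Type*} [Group G] (H K : Subgroup G) [H.Normal] [K.Normal] (c : ℕ) :
    itC H K c ≤ H := by
  induction c with
  | zero => exact le_rfl
  | succ c ih => exact (Subgroup.commutator_le_left _ _).trans ih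

theorem map_itC {G G' : Type*} [Group G] [Group G'] (φ : G →* G') (H K : Subgroup G) (c : ℕ) :
    (itC H K c).map φ = itC (H.map φ) (K.map φ) c := by
  induction c with
  | zero => rfl
  | succ c ih => simp only [itC, Subgroup.map_commutator, ih]

open scoped commutatorElement in
theorem normal_sup_commutator {G : Type*} [Group G] {H K : Subgroup G} (h : H ⊔ K = ⊤) :
    (H ⊔ ⁅H, K⁆).Normal := by
  have conj_mem : ∀ k ∈ K, ∀ x ∈ H, k * x * k⁻¹ ∈ H ⊔ ⁅H, K⁆ := fun k hk x hx => by
    have h1 : ⁅x, k⁆⁻¹ * x ∈ H ⊔ ⁅H, K⁆ :=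
      mul_mem (inv_mem (Subgroup.mem_sup_right (Subgroup.commutator_mem_commutator hx hk)))
        (Subgroup.mem_sup_left hx)
    convert h1 using 1
    simp only [commutatorElement_def]
    group
  have le_comap : ∀ k ∈ K, H ⊔ ⁅H, K⁆ ≤ (H ⊔ ⁅H, K⁆).comap (MulAut.conj k).toMonoidHom := by
    intro k hk
    refine sup_le (fun x hx => conj_mem k hk x hx) (Subgroup.commutator_le.2 fun x hx y hy => ?_)
    have h1 := mul_mem (conj_mem k hk x hx) (inv_mem (conj_mem (k * y) (mul_mem hk hy) x hx))
    change k * (x * y * x⁻¹ * y⁻¹) * k⁻¹ ∈ H ⊔ ⁅H, K⁆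
    convert h1 using 1
    group
  refine Subgroup.normalizer_eq_top_iff.1 (top_le_iff.1 (h ▸ sup_le ?_ fun k hk => ?_))
  · exact le_sup_left.trans Subgroup.le_normalizer
  · refine Subgroup.mem_normalizer_iff.2 fun x => ⟨fun hx => le_comap k hk hx, fun hx => ?_⟩
    have h1 := le_comap k⁻¹ (inv_mem hk) hx
    simpa [mul_assoc] using h1

/-- If an endomorphism `φ` preserves `K`, fixes `H` pointwise and kills `N`, then `H` and `N`
have disjoint images modulo `K`. -/
theorem map_mk'_inf_map_mk'_eq_bot {G : Type*} [Group G] {H N K : Subgroup G} [K.Normal]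
    (φ : G →* G) (hH : ∀ x ∈ H, φ x = x) (hN : N ≤ φ.ker) (hK : K.map φ ≤ K) :
    H.map (QuotientGroup.mk' K) ⊓ N.map (QuotientGroup.mk' K) = ⊥ := by
  refine (Subgroup.eq_bot_iff_forall _).2 ?_
  rintro _ ⟨⟨x, hx, rfl⟩, n, hn, hnx⟩
  have hmem := hK (Subgroup.mem_map_of_mem φ (QuotientGroup.eq.1 hnx))
  rw [map_mul, map_inv, MonoidHom.mem_ker.1 (hN hn), hH x hx, inv_one, one_mul] at hmem
  exact (QuotientGroup.eq_one_iff _).2 hmem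

section Retraction

variable {A B F₁ F₂ : Type*} [Group A] [Group B] [Group F₁] [Group F₂]

theorem Fs₁_sup_Fs₂ : Fs₁ F₁ F₂ ⊔ Fs₂ F₁ F₂ = ⊤ :=
  Coprod.range_inl_sup_range_inr

theorem Fs₁_le_ker_snd : Fs₁ F₁ F₂ ≤ (Coprod.snd : F₁ ∗ F₂ →* F₂).ker := by
  rintro _ ⟨f, rfl⟩
  simp [MonoidHom.mem_ker]

theorem Fs₁_sup_commutator_le_ker_snd :
    Fs₁ F₁ F₂ ⊔ ⁅Fs₁ F₁ F₂, Fs₂ F₁ F₂⁆ ≤ (Coprod.snd : F₁ ∗ F₂ →* F₂).ker :=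
  sup_le Fs₁_le_ker_snd <|
    (Subgroup.commutator_mono Fs₁_le_ker_snd le_top).trans (Subgroup.commutator_le_left _ _)

theorem Ssub_le_ker_snd (θ : B →* MulAut A) (ν₁ : F₁ →* A) (ν₂ : F₂ →* B) :
    Ssub F₁ F₂ θ ν₁ ν₂ ≤ (Coprod.snd : F₁ ∗ F₂ →* F₂).ker := by
  refine Subgroup.normalClosure_le_normal ?_
  rintro _ ⟨f₁, f₁', f₂, -, rfl⟩
  simp [MonoidHom.mem_ker, pc]

theorem Pc_le_ker_snd (ν₂ : F₂ →* B) (c : ℕ) :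
    Pc F₁ F₂ ν₂ c ≤ (Coprod.snd : F₁ ∗ F₂ →* F₂).ker := by
  refine Subgroup.normalClosure_le_normal ?_
  rintro _ ⟨r, -, l, -, -, ⟨f, hf, hf₁⟩, rfl⟩
  rw [SetLike.mem_coe, MonoidHom.mem_ker, map_itc]
  exact itc_eq_one_of_one_mem _ (List.mem_map.2 ⟨f, hf, Fs₁_le_ker_snd hf₁⟩)

/-- The retraction of `F₁ ∗ F₂` onto `F₂` maps `K` into its factor `[R₂, _c F₂]`. -/
theorem map_inr_snd_le (θ : B →* MulAut A) (ν₁ : F₁ →* A) (ν₂ : F₂ →* B) (c : ℕ) :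
    (itC (Rs₂ F₁ F₂ ν₂) (Fs₂ F₁ F₂) c ⊔ Pc F₁ F₂ ν₂ c ⊔ itC (Ssub F₁ F₂ θ ν₁ ν₂) ⊤ c).map
      ((Coprod.inr : F₂ →* F₁ ∗ F₂).comp Coprod.snd) ≤
      itC (Rs₂ F₁ F₂ ν₂) (Fs₂ F₁ F₂) c := by
  have of_ker : ∀ H : Subgroup (F₁ ∗ F₂), H ≤ (Coprod.snd : F₁ ∗ F₂ →* F₂).ker →
      H.map ((Coprod.inr : F₂ →* F₁ ∗ F₂).comp Coprod.snd) ≤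
        itC (Rs₂ F₁ F₂ ν₂) (Fs₂ F₁ F₂) c := by
    rintro H hH _ ⟨x, hx, rfl⟩
    rw [MonoidHom.comp_apply, MonoidHom.mem_ker.1 (hH hx), map_one]
    exact one_mem _
  rw [Subgroup.map_sup, Subgroup.map_sup]
  refine sup_le (sup_le ?_ (of_ker _ (Pc_le_ker_snd ν₂ c)))
    (of_ker _ ((itC_le_left _ _ c).trans (Ssub_le_ker_snd θ ν₁ ν₂)))
  have hinr : ((Coprod.inr : F₂ →* F₁ ∗ F₂).comp Coprod.snd).comp
      (Coprod.inr : F₂ →* F₁ ∗ F₂) = Coprod.inr := rfl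
  rw [map_itC, Rs₂, Fs₂, Subgroup.map_map, MonoidHom.map_range, hinr]

end Retraction

/-- With the standard setup, fix `c ≥ 1` and let
`K = [R₂, _c F₂] · ∏[R₂,F₁,F₂]_c · [S, _c F]` (a normal subgroup of `F = F₁ ∗ F₂`; this
true normality fact is supplied as the instance argument `hK`).  Then in `F/K` the
images of `F₂` and of `F₁[F₁,F₂]` intersect trivially, and `F/K` is the semidirect
product of the image of `F₂` and the (normal) image of `F₁[F₁,F₂]`. -/
theorem quotient_by_K_semidirect
    {A B F₁ F₂ : Type*} [Group A] [Group B] [Group F₁] [Group F₂]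
    [IsFreeGroup F₁] [IsFreeGroup F₂]
    (θ : B →* MulAut A) (ν₁ : F₁ →* A) (ν₂ : F₂ →* B)
    (hν₁ : Function.Surjective ν₁) (hν₂ : Function.Surjective ν₂)
    (c : ℕ) (hc : 1 ≤ c)
    [hK : (itC (Rs₂ F₁ F₂ ν₂) (Fs₂ F₁ F₂) c ⊔ Pc F₁ F₂ ν₂ c ⊔
            itC (Ssub F₁ F₂ θ ν₁ ν₂) ⊤ c).Normal] :
    ((Fs₂ F₁ F₂).map
        (QuotientGroup.mk' (itC (Rs₂ F₁ F₂ ν₂) (Fs₂ F₁ F₂) c ⊔ Pc F₁ F₂ ν₂ c ⊔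
          itC (Ssub F₁ F₂ θ ν₁ ν₂) ⊤ c)) ⊓
      ((Fs₁ F₁ F₂ ⊔ ⁅Fs₁ F₁ F₂, Fs₂ F₁ F₂⁆).map
        (QuotientGroup.mk' (itC (Rs₂ F₁ F₂ ν₂) (Fs₂ F₁ F₂) c ⊔ Pc F₁ F₂ ν₂ c ⊔
          itC (Ssub F₁ F₂ θ ν₁ ν₂) ⊤ c))) = ⊥) ∧
    (((Fs₁ F₁ F₂ ⊔ ⁅Fs₁ F₁ F₂, Fs₂ F₁ F₂⁆).map
        (QuotientGroup.mk' (itC (Rs₂ F₁ F₂ ν₂) (Fs₂ F₁ F₂) c ⊔ Pc F₁ F₂ ν₂ c ⊔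
          itC (Ssub F₁ F₂ θ ν₁ ν₂) ⊤ c))).Normal) ∧
    ((Fs₂ F₁ F₂).map
        (QuotientGroup.mk' (itC (Rs₂ F₁ F₂ ν₂) (Fs₂ F₁ F₂) c ⊔ Pc F₁ F₂ ν₂ c ⊔
          itC (Ssub F₁ F₂ θ ν₁ ν₂) ⊤ c)) ⊔
      ((Fs₁ F₁ F₂ ⊔ ⁅Fs₁ F₁ F₂, Fs₂ F₁ F₂⁆).map
        (QuotientGroup.mk' (itC (Rs₂ F₁ F₂ ν₂) (Fs₂ F₁ F₂) c ⊔ Pc F₁ F₂ ν₂ c ⊔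
          itC (Ssub F₁ F₂ θ ν₁ ν₂) ⊤ c))) = ⊤) := by
  refine ⟨map_mk'_inf_map_mk'_eq_bot ((Coprod.inr : F₂ →* F₁ ∗ F₂).comp Coprod.snd) ?_ ?_ ?_,
    (normal_sup_commutator Fs₁_sup_Fs₂).map _ (QuotientGroup.mk'_surjective _), ?_⟩
  · rintro _ ⟨b, rfl⟩
    rfl
  · exact Fs₁_sup_commutator_le_ker_snd.trans fun x hx => by
      rw [MonoidHom.mem_ker, MonoidHom.comp_apply, MonoidHom.mem_ker.1 hx, map_one]
  · exact (map_inr_snd_le θ ν₁ ν₂ c).trans (le_sup_left.trans le_sup_left)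
  · rw [← Subgroup.map_sup, ← top_le_iff,
      ← Subgroup.map_top_of_surjective _ (QuotientGroup.mk'_surjective _)]
    refine Subgroup.map_mono ?_
    rw [← Fs₁_sup_Fs₂]
    exact sup_le (le_sup_left.trans le_sup_right) le_sup_left

end Paper
end
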